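/- Let α > 1 and let m be a measurable function on the torus 𝕋^d belonging to the weak Lebesgue space L^{α,∞}(𝕋^d), i.e., there exists c > 0 such that |{ξ ∈ (0,1)^d : |m(ξ)| ≥ s}| ≤ c/s^α for all s > 0. Then the Fourier multiplier operator T_m extends to a bounded operator from ℓ^p(ℤ^d) to ℓ^q(ℤ^d) whenever 1 < p ≤ 2 ≤ q < ∞ and 1/p − 1/q = 1/α; that is, there is a constant C such that ‖T_m f‖_{ℓ^q} ≤ C ‖f‖_{ℓ^p} for all f ∈ ℓ^p(ℤ^d). -/

import Mathlib

open MeasureTheory Real Complex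

/-- The open unit cube `(0,1)^d` in `ℝ^d`. -/
noncomputable def unitCube (d : ℕ) : Set (Fin d → ℝ) :=
  Set.univ.pi fun _ => Set.Ioo (0 : ℝ) 1

/-- Discrete Fourier transform on `ℤ^d`: `F(f)(ξ) = ∑_{n ∈ ℤ^d} f(n) e^{2πi n·ξ}`. -/
noncomputable def dft (d : ℕ) (f : (Fin d → ℤ) → ℂ) (ξ : Fin d → ℝ) : ℂ :=
  ∑' n : Fin d → ℤ, f n * Complex.exp (2 * Real.pi * Complex.I * ∑ i, (n i : ℂ) * (ξ i : ℂ))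

/-- The Fourier multiplier operator `T_m`, given by `T_m f = F⁻¹(m · F(f))`. -/
noncomputable def Tmult (d : ℕ) (m : (Fin d → ℝ) → ℂ) (f : (Fin d → ℤ) → ℂ)
    (n : Fin d → ℤ) : ℂ :=
  ∫ ξ in unitCube d, m ξ * dft d f ξ *
    Complex.exp (-(2 * Real.pi * Complex.I) * ∑ i, (ξ i : ℂ) * (n i : ℂ))

/-- The `ℓ^p(ℤ^d)` norm, as the `L^p` norm with respect to counting measure. -/
noncomputable def lpNorm (d : ℕ) (f : (Fin d → ℤ) → ℂ) (p : ℝ) : ENNReal :=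
  eLpNorm f (ENNReal.ofReal p) (Measure.count : Measure (Fin d → ℤ))

noncomputable def latticeChar (d : ℕ) (n : Fin d → ℤ) (ξ : Fin d → ℝ) : ℂ :=
  Complex.exp (2 * Real.pi * Complex.I * ∑ i, (n i : ℂ) * (ξ i : ℂ))

theorem latticeChar_eq_exp_ofReal (d : ℕ) (n : Fin d → ℤ) (ξ : Fin d → ℝ) :
    latticeChar d n ξ = Complex.exp ((2 * Real.pi * ∑ i, (n i : ℝ) * ξ i : ℝ) * Complex.I) := by
  unfold latticeChar
  congr 1
  push_cast
  ring

theorem norm_latticeChar (d : ℕ) (n : Fin d → ℤ) (ξ : Fin d → ℝ) : ‖latticeChar d n ξ‖ = 1 := by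
  rw [latticeChar_eq_exp_ofReal, Complex.norm_exp_ofReal_mul_I]

theorem continuous_latticeChar (d : ℕ) (n : Fin d → ℤ) : Continuous (latticeChar d n) := by
  unfold latticeChar
  fun_prop

theorem conj_latticeChar (d : ℕ) (n : Fin d → ℤ) (ξ : Fin d → ℝ) :
    (starRingEnd ℂ) (latticeChar d n ξ) =
      Complex.exp (-(2 * Real.pi * Complex.I) * ∑ i, (ξ i : ℂ) * (n i : ℂ)) := by
  rw [latticeChar_eq_exp_ofReal, ← Complex.exp_conj]
  congr 1
  simp only [map_mul, Complex.conj_ofReal, Complex.conj_I]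
  push_cast
  simp only [mul_comm (ξ _ : ℂ)]
  ring

theorem integral_Ioo_exp_int (k : ℤ) :
    ∫ x in Set.Ioo (0 : ℝ) 1, Complex.exp (2 * Real.pi * Complex.I * k * x) =
      if k = 0 then 1 else 0 := by
  rw [← integral_Ioc_eq_integral_Ioo, ← intervalIntegral.integral_of_le zero_le_one]
  split_ifs with h
  · simp [h]
  · have hk : (2 * Real.pi * Complex.I * k : ℂ) ≠ 0 := by
      simp [Real.pi_ne_zero, h]
    rw [integral_exp_mul_complex hk]
    have : Complex.exp (2 * Real.pi * Complex.I * k) = 1 := by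
      rw [mul_comm]; exact Complex.exp_int_mul_two_pi_mul_I k
    simp [this]

theorem volume_restrict_unitCube (d : ℕ) :
    (volume.restrict (unitCube d) : Measure (Fin d → ℝ)) =
      Measure.pi fun _ => volume.restrict (Set.Ioo (0 : ℝ) 1) := by
  rw [unitCube, volume_pi, Measure.restrict_pi_pi]

theorem isProbabilityMeasure_unitCube (d : ℕ) :
    IsProbabilityMeasure (volume.restrict (unitCube d) : Measure (Fin d → ℝ)) := by
  rw [volume_restrict_unitCube]
  have : IsProbabilityMeasure (volume.restrict (Set.Ioo (0 : ℝ) 1)) := ⟨by simp⟩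
  infer_instance

theorem integral_latticeChar_mul_conj (d : ℕ) (n k : Fin d → ℤ) :
    ∫ ξ in unitCube d, latticeChar d n ξ * (starRingEnd ℂ) (latticeChar d k ξ) =
      if n = k then 1 else 0 := by
  have h : ∀ ξ : Fin d → ℝ, latticeChar d n ξ * (starRingEnd ℂ) (latticeChar d k ξ) =
      ∏ i, Complex.exp (2 * Real.pi * Complex.I * (n i - k i : ℤ) * ξ i) := by
    intro ξ
    rw [conj_latticeChar, latticeChar, ← Complex.exp_add, ← Complex.exp_sum]
    congr 1
    rw [neg_mul, ← sub_eq_add_neg, ← mul_sub, ← Finset.sum_sub_distrib, Finset.mul_sum]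
    refine Finset.sum_congr rfl fun i _ => ?_
    push_cast
    ring
  simp_rw [h]
  rw [volume_restrict_unitCube, integral_fintype_prod_eq_prod
    (fun i (x : ℝ) => Complex.exp (2 * Real.pi * Complex.I * (n i - k i : ℤ) * x))]
  simp_rw [integral_Ioo_exp_int, sub_eq_zero]
  split_ifs with hnk
  · simp [hnk]
  · obtain ⟨i, hi⟩ := Function.ne_iff.1 hnk
    exact Finset.prod_eq_zero (Finset.mem_univ i) (by simp [hi])

theorem dft_eq_tsum (d : ℕ) (f : (Fin d → ℤ) → ℂ) (ξ : Fin d → ℝ) :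
    dft d f ξ = ∑' n, f n * latticeChar d n ξ := rfl

theorem continuous_dft {d : ℕ} {f : (Fin d → ℤ) → ℂ} (hf : Summable fun n => ‖f n‖) :
    Continuous (dft d f) :=
  continuous_tsum (u := fun n => ‖f n‖)
    (fun n => continuous_const.mul (continuous_latticeChar d n)) hf
    (fun n ξ => by
      change ‖f n * latticeChar d n ξ‖ ≤ _
      rw [norm_mul, norm_latticeChar, mul_one])

theorem summable_mul_latticeChar {d : ℕ} {f : (Fin d → ℤ) → ℂ}
    (hf : Summable fun n => ‖f n‖) (ξ : Fin d → ℝ) :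
    Summable fun n => f n * latticeChar d n ξ :=
  Summable.of_norm (by simpa [norm_latticeChar] using hf)

theorem norm_dft_le {d : ℕ} {f : (Fin d → ℤ) → ℂ} (hf : Summable fun n => ‖f n‖)
    (ξ : Fin d → ℝ) : ‖dft d f ξ‖ ≤ ∑' n, ‖f n‖ := by
  rw [dft_eq_tsum]
  refine (norm_tsum_le_tsum_norm (by simpa [norm_latticeChar] using hf)).trans_eq ?_
  simp [norm_latticeChar]

theorem dft_add {d : ℕ} {f g : (Fin d → ℤ) → ℂ} (hf : Summable fun n => ‖f n‖)
    (hg : Summable fun n => ‖g n‖) (ξ : Fin d → ℝ) :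
    dft d (f + g) ξ = dft d f ξ + dft d g ξ := by
  simp only [dft_eq_tsum, Pi.add_apply, add_mul]
  exact (summable_mul_latticeChar hf ξ).tsum_add (summable_mul_latticeChar hg ξ)

theorem hasSum_integral_dft_mul {d : ℕ} {f : (Fin d → ℤ) → ℂ} (hf : Summable fun n => ‖f n‖)
    {H : (Fin d → ℝ) → ℂ} (hH : Continuous H) {M : ℝ} (hM : ∀ ξ, ‖H ξ‖ ≤ M) :
    HasSum (fun n => f n * ∫ ξ in unitCube d, latticeChar d n ξ * H ξ)
      (∫ ξ in unitCube d, dft d f ξ * H ξ) := by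
  have := isProbabilityMeasure_unitCube d
  have hbd : ∀ n ξ, ‖f n * (latticeChar d n ξ * H ξ)‖ ≤ ‖f n‖ * M := fun n ξ => by
    rw [norm_mul, norm_mul, norm_latticeChar, one_mul]
    exact mul_le_mul_of_nonneg_left (hM ξ) (norm_nonneg _)
  have hint : ∀ n, Integrable (fun ξ => f n * (latticeChar d n ξ * H ξ))
      (volume.restrict (unitCube d)) := fun n =>
    Integrable.of_bound
      (continuous_const.mul ((continuous_latticeChar d n).mul hH)).aestronglyMeasurable
      (‖f n‖ * M) (Filter.Eventually.of_forall (hbd n))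
  have key := hasSum_integral_of_summable_integral_norm hint
    (Summable.of_nonneg_of_le (fun n => integral_nonneg fun ξ => norm_nonneg _)
      (fun n => by
        refine (integral_mono (hint n).norm (integrable_const (‖f n‖ * M)) (hbd n)).trans_eq ?_
        simp) (hf.mul_right M))
  simp_rw [integral_const_mul] at key
  have hsum : ∀ ξ, ∑' n, f n * (latticeChar d n ξ * H ξ) = dft d f ξ * H ξ := fun ξ => by
    rw [dft_eq_tsum, ← (summable_mul_latticeChar hf ξ).tsum_mul_right]
    simp_rw [mul_assoc]
  simpa only [hsum] using key

theorem integral_dft_mul_conj_latticeChar {d : ℕ} {f : (Fin d → ℤ) → ℂ}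
    (hf : Summable fun n => ‖f n‖) (k : Fin d → ℤ) :
    ∫ ξ in unitCube d, dft d f ξ * (starRingEnd ℂ) (latticeChar d k ξ) = f k := by
  have h := hasSum_integral_dft_mul hf (H := fun ξ => (starRingEnd ℂ) (latticeChar d k ξ))
    (Complex.continuous_conj.comp (continuous_latticeChar d k)) (M := 1)
    (fun ξ => by simp [norm_latticeChar])
  simp_rw [integral_latticeChar_mul_conj] at h
  refine h.unique ?_
  convert hasSum_single k (f := fun n => f n * if n = k then (1 : ℂ) else 0) ?_ using 1
  · simp
  · intro n hn
    simp [hn]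

theorem lintegral_enorm_dft_sq {d : ℕ} {f : (Fin d → ℤ) → ℂ} (hf : Summable fun n => ‖f n‖) :
    ∫⁻ ξ in unitCube d, ‖dft d f ξ‖ₑ ^ (2 : ℝ) = ∑' n, ‖f n‖ₑ ^ (2 : ℝ) := by
  have := isProbabilityMeasure_unitCube d
  have h := hasSum_integral_dft_mul hf (H := fun ξ => (starRingEnd ℂ) (dft d f ξ))
    (Complex.continuous_conj.comp (continuous_dft hf)) (M := ∑' n, ‖f n‖)
    (fun ξ => by simpa using norm_dft_le hf ξ)
  have hc : ∀ n, ∫ ξ in unitCube d, latticeChar d n ξ * (starRingEnd ℂ) (dft d f ξ) =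
      (starRingEnd ℂ) (f n) := fun n => by
    rw [← integral_dft_mul_conj_latticeChar hf n, ← integral_conj]
    simp [mul_comm]
  simp_rw [hc, Complex.mul_conj, integral_complex_ofReal, Complex.normSq_eq_norm_sq] at h
  have h' := Complex.hasSum_ofReal.1 h
  have e : ∀ z : ℂ, ‖z‖ₑ ^ (2 : ℝ) = ENNReal.ofReal (‖z‖ ^ 2) := fun z => by
    rw [ENNReal.ofReal_pow (norm_nonneg _), ofReal_norm]
    norm_cast
  simp_rw [e]
  rw [← ENNReal.ofReal_tsum_of_nonneg (fun n => by positivity) h'.summable, h'.tsum_eq,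
    ofReal_integral_eq_lintegral_ofReal]
  · refine Integrable.of_bound ((continuous_dft hf).norm.pow 2).aestronglyMeasurable
      ((∑' n, ‖f n‖) ^ 2) (Filter.Eventually.of_forall fun ξ => ?_)
    rw [norm_pow, norm_norm]
    exact pow_le_pow_left₀ (norm_nonneg _) (norm_dft_le hf ξ) 2
  · exact Filter.Eventually.of_forall fun ξ => by positivity

theorem setLIntegral_sq_le_of_weak {X : Type*} [MeasurableSpace X] {μ : Measure X} {φ : X → ℝ}
    (hφm : Measurable φ) (hφ0 : ∀ x, 0 ≤ φ x) {c : ℝ}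
    (hφ : ∀ s : ℝ, 0 < s → μ {x | s ≤ φ x} ≤ ENNReal.ofReal (c / s)) (t : ℝ) :
    ∫⁻ x in {x | φ x ≤ t}, ENNReal.ofReal (φ x ^ 2) ∂μ ≤ ENNReal.ofReal (2 * c * t) := by
  rcases lt_or_ge t 0 with ht | ht
  · have : {x | φ x ≤ t} = ∅ := by
      ext x
      simpa using ht.trans_le (hφ0 x)
    simp [this]
  have hS : MeasurableSet {x | φ x ≤ t} := measurableSet_le hφm measurable_const
  set ψ : X → ℝ := {x | φ x ≤ t}.indicator φ with hψ
  have hψm : Measurable ψ := hφm.indicator hS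
  have hψ0 : ∀ x, 0 ≤ ψ x := fun x => Set.indicator_nonneg (fun x _ => hφ0 x) x
  have hψt : ∀ x, ψ x ≤ t := fun x => Set.indicator_le' (fun x hx => hx) (fun x _ => ht) x
  have hψφ : ∀ x, ψ x ≤ φ x := fun x => Set.indicator_le_self' (fun x _ => hφ0 x) x
  have h1 : ∫⁻ x in {x | φ x ≤ t}, ENNReal.ofReal (φ x ^ 2) ∂μ =
      ∫⁻ x, ENNReal.ofReal (ψ x ^ (2 : ℝ)) ∂μ := by
    rw [← lintegral_indicator hS]
    refine lintegral_congr fun x => ?_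
    by_cases hx : x ∈ {x | φ x ≤ t} <;> simp [hψ, hx]
  rw [h1, lintegral_rpow_eq_lintegral_meas_lt_mul μ (Filter.Eventually.of_forall hψ0)
    hψm.aemeasurable two_pos]
  have h2 : ∫⁻ u in Set.Ioi (0 : ℝ), μ {x | u < ψ x} * ENNReal.ofReal (u ^ ((2 : ℝ) - 1)) ≤
      ∫⁻ u in Set.Ioi (0 : ℝ), (Set.Ioo 0 t).indicator (fun _ => ENNReal.ofReal c) u := by
    refine setLIntegral_mono' measurableSet_Ioi fun u hu => ?_
    have hu : 0 < u := hu
    by_cases hut : u < t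
    · rw [Set.indicator_of_mem (show u ∈ Set.Ioo 0 t from ⟨hu, hut⟩)]
      have : μ {x | u < ψ x} ≤ ENNReal.ofReal (c / u) :=
        (measure_mono fun x hx => (le_of_lt hx).trans (hψφ x)).trans (hφ u hu)
      calc _ ≤ ENNReal.ofReal (c / u) * ENNReal.ofReal (u ^ ((2 : ℝ) - 1)) := by gcongr
        _ = ENNReal.ofReal c := by
          rw [← ENNReal.ofReal_mul' (by positivity)]
          norm_num
          field_simp
    · have : {x | u < ψ x} = ∅ := by
        ext x
        simpa using (hψt x).trans (not_lt.1 hut)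
      simp [this]
  refine (mul_le_mul_right h2 _).trans ?_
  rw [setLIntegral_indicator measurableSet_Ioo, setLIntegral_const,
    Set.inter_eq_left.2 (fun u hu => hu.1), Real.volume_Ioo, sub_zero,
    ← ENNReal.ofReal_mul' ht, ← ENNReal.ofReal_mul (by norm_num), mul_assoc]

theorem setLIntegral_sq_lt_norm_dft_le {d : ℕ} {φ : (Fin d → ℝ) → ℝ}
    (hφm : Measurable φ) (hφ0 : ∀ x, 0 ≤ φ x) {c : ℝ} (hc : 0 ≤ c)
    (hφ : ∀ s : ℝ, 0 < s →
      volume.restrict (unitCube d) {x | s ≤ φ x} ≤ ENNReal.ofReal (c / s))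
    {f : (Fin d → ℤ) → ℂ} (hf : Summable fun n => ‖f n‖) {l : ℝ} (hl : 0 < l) :
    ∫⁻ x in {x | l * φ x < ‖dft d f x‖}, ENNReal.ofReal (φ x ^ 2)
        ∂(volume.restrict (unitCube d)) ≤
      ∑' n, ((if l < ‖f n‖ then ENNReal.ofReal (4 * c / l * ‖f n‖) else 0) +
        (if l < ‖f n‖ then 0 else ENNReal.ofReal (4 / l ^ 2 * ‖f n‖ ^ 2))) := by
  set f₁ : (Fin d → ℤ) → ℂ := fun n => if l < ‖f n‖ then f n else 0 with hf₁
  set f₂ : (Fin d → ℤ) → ℂ := fun n => if l < ‖f n‖ then 0 else f n with hf₂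
  have hs₁ : Summable fun n => ‖f₁ n‖ := by
    refine Summable.of_nonneg_of_le (fun n => norm_nonneg _) (fun n => ?_) hf
    simp only [hf₁]
    split_ifs <;> simp
  have hs₂ : Summable fun n => ‖f₂ n‖ := by
    refine Summable.of_nonneg_of_le (fun n => norm_nonneg _) (fun n => ?_) hf
    simp only [hf₂]
    split_ifs <;> simp
  have hadd : f = f₁ + f₂ := by
    ext n
    simp only [hf₁, hf₂, Pi.add_apply]
    split_ifs <;> simp
  set A := ∑' n, ‖f₁ n‖ with hA
  have hmS : MeasurableSet {x | φ x ≤ 2 * A / l} := measurableSet_le hφm measurable_const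
  calc _ ≤ ∫⁻ x in {x | l * φ x < ‖dft d f x‖},
        ({x | φ x ≤ 2 * A / l}.indicator (fun x => ENNReal.ofReal (φ x ^ 2)) x +
          ENNReal.ofReal (4 / l ^ 2) * ‖dft d f₂ x‖ₑ ^ (2 : ℝ))
          ∂(volume.restrict (unitCube d)) := by
        refine setLIntegral_mono' (measurableSet_lt (by fun_prop)
          (continuous_dft hf).norm.measurable) fun x hx => ?_
        have hx : l * φ x < ‖dft d f x‖ := hx
        by_cases hxs : φ x ≤ 2 * A / l
        · rw [Set.indicator_of_mem (show x ∈ {x | φ x ≤ 2 * A / l} from hxs)]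
          exact le_self_add
        · refine le_add_left ?_
          rw [not_le, div_lt_iff₀ hl] at hxs
          have h1 : ‖dft d f x‖ ≤ A + ‖dft d f₂ x‖ := by
            rw [hadd, dft_add hs₁ hs₂]
            exact (norm_add_le _ _).trans (by gcongr; exact norm_dft_le hs₁ x)
          have h2 : φ x ≤ 2 / l * ‖dft d f₂ x‖ := by
            rw [div_mul_eq_mul_div, le_div_iff₀ hl]
            nlinarith
          rw [← ofReal_norm, ENNReal.ofReal_rpow_of_nonneg (norm_nonneg _) (by norm_num),
            ← ENNReal.ofReal_mul (by positivity)]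
          refine ENNReal.ofReal_le_ofReal ?_
          calc φ x ^ 2 ≤ (2 / l * ‖dft d f₂ x‖) ^ 2 := pow_le_pow_left₀ (hφ0 x) h2 2
            _ = _ := by
              rw [Real.rpow_two]
              ring
    _ ≤ ∫⁻ x, ({x | φ x ≤ 2 * A / l}.indicator (fun x => ENNReal.ofReal (φ x ^ 2)) x +
          ENNReal.ofReal (4 / l ^ 2) * ‖dft d f₂ x‖ₑ ^ (2 : ℝ))
          ∂(volume.restrict (unitCube d)) := setLIntegral_le_lintegral _ _
    _ = ∫⁻ x in {x | φ x ≤ 2 * A / l}, ENNReal.ofReal (φ x ^ 2) ∂(volume.restrict (unitCube d)) +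
          ENNReal.ofReal (4 / l ^ 2) * ∑' n, ‖f₂ n‖ₑ ^ (2 : ℝ) := by
        rw [lintegral_add_left ((hφm.pow_const 2).ennreal_ofReal.indicator hmS),
          lintegral_indicator hmS, lintegral_const_mul, lintegral_enorm_dft_sq hs₂]
        exact (continuous_dft hs₂).measurable.enorm.pow_const _
    _ ≤ ENNReal.ofReal (2 * c * (2 * A / l)) +
          ENNReal.ofReal (4 / l ^ 2) * ∑' n, ‖f₂ n‖ₑ ^ (2 : ℝ) := by
        gcongr
        exact setLIntegral_sq_le_of_weak hφm hφ0 hφ _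
    _ = _ := by
        rw [ENNReal.tsum_add]
        congr 1
        · rw [show 2 * c * (2 * A / l) = 4 * c / l * A by ring,
            ENNReal.ofReal_mul (by positivity), hA,
            ENNReal.ofReal_tsum_of_nonneg (fun n => norm_nonneg _) hs₁, ← ENNReal.tsum_mul_left]
          refine tsum_congr fun n => ?_
          rw [← ENNReal.ofReal_mul (by positivity)]
          simp only [hf₁]
          split_ifs <;> simp
        · rw [← ENNReal.tsum_mul_left]
          refine tsum_congr fun n => ?_
          rw [← ofReal_norm, ENNReal.ofReal_rpow_of_nonneg (norm_nonneg _) (by norm_num),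
            ← ENNReal.ofReal_mul (by positivity), Real.rpow_two]
          simp only [hf₂]
          split_ifs <;> simp

theorem lintegral_Ioi_ite_rpow_le {p : ℝ} (hp : 1 < p) (hp2 : p < 2) {c : ℝ} (hc : 0 ≤ c)
    {a : ℝ} (ha : 0 ≤ a) :
    ∫⁻ l in Set.Ioi (0 : ℝ), ((if l < a then ENNReal.ofReal (4 * c / l * a) else 0) +
        (if l < a then 0 else ENNReal.ofReal (4 / l ^ 2 * a ^ 2))) * ENNReal.ofReal (l ^ (p - 1)) ≤
      ENNReal.ofReal (4 * c / (p - 1) + 4 / (2 - p)) * ENNReal.ofReal (a ^ p) := by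
  rcases ha.eq_or_lt with rfl | ha
  · refine le_of_eq_of_le ?_ zero_le
    rw [setLIntegral_congr_fun (g := fun _ => 0) measurableSet_Ioi]
    · simp
    · intro l hl
      have hl : 0 < l := hl
      simp
  have hu : Set.Ioi (0 : ℝ) = Set.Ioo 0 a ∪ Set.Ici a := (Set.Ioo_union_Ici_eq_Ioi ha).symm
  rw [hu]
  refine (lintegral_union_le _ _ _).trans ?_
  have h1 : ∫⁻ l in Set.Ioo (0 : ℝ) a, ((if l < a then ENNReal.ofReal (4 * c / l * a) else 0) +
        (if l < a then 0 else ENNReal.ofReal (4 / l ^ 2 * a ^ 2))) * ENNReal.ofReal (l ^ (p - 1)) =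
      ENNReal.ofReal (4 * c / (p - 1) * a ^ p) := by
    have hint : IntegrableOn (fun l : ℝ => 4 * c * a * l ^ (p - 2)) (Set.Ioo 0 a) := by
      refine Integrable.const_mul ?_ _
      have := (intervalIntegral.intervalIntegrable_rpow' (a := 0) (b := a)
        (show -1 < p - 2 by linarith))
      rw [intervalIntegrable_iff_integrableOn_Ioo_of_le ha.le] at this
      exact this
    calc _ = ∫⁻ l in Set.Ioo (0 : ℝ) a, ENNReal.ofReal (4 * c * a * l ^ (p - 2)) := by
          refine setLIntegral_congr_fun measurableSet_Ioo fun l hl => ?_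
          have hl0 : 0 < l := hl.1
          simp only [hl.2, if_true, add_zero]
          rw [← ENNReal.ofReal_mul (by positivity)]
          congr 1
          rw [show p - 1 = (p - 2) + 1 by ring, Real.rpow_add_one hl0.ne']
          field_simp
      _ = _ := by
          rw [← ofReal_integral_eq_lintegral_ofReal hint
            ((ae_restrict_mem measurableSet_Ioo).mono fun l hl => by
              have hl0 : 0 < l := hl.1
              positivity)]
          congr 1
          rw [integral_const_mul, ← integral_Ioc_eq_integral_Ioo,
            ← intervalIntegral.integral_of_le ha.le, integral_rpow (Or.inl (by linarith)),
            Real.zero_rpow (by linarith), show p - 2 + 1 = p - 1 by ring,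
            show a ^ p = a ^ (p - 1) * a by rw [← Real.rpow_add_one ha.ne']; ring_nf]
          ring
  have h2 : ∫⁻ l in Set.Ici a, ((if l < a then ENNReal.ofReal (4 * c / l * a) else 0) +
        (if l < a then 0 else ENNReal.ofReal (4 / l ^ 2 * a ^ 2))) * ENNReal.ofReal (l ^ (p - 1)) =
      ENNReal.ofReal (4 / (2 - p) * a ^ p) := by
    have hint : IntegrableOn (fun l : ℝ => 4 * a ^ 2 * l ^ (p - 3)) (Set.Ioi a) :=
      (integrableOn_Ioi_rpow_of_lt (by linarith) ha).const_mul _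
    calc _ = ∫⁻ l in Set.Ici a, ENNReal.ofReal (4 * a ^ 2 * l ^ (p - 3)) := by
          refine setLIntegral_congr_fun measurableSet_Ici fun l hl => ?_
          have hl0 : 0 < l := ha.trans_le hl
          have hl' : ¬ l < a := not_lt.2 hl
          simp only [hl', if_false, zero_add]
          rw [← ENNReal.ofReal_mul (by positivity)]
          congr 1
          rw [show p - 1 = (p - 3) + (2 : ℕ) by push_cast; ring, Real.rpow_add_natCast hl0.ne']
          field_simp
      _ = _ := by
          rw [setLIntegral_congr Ioi_ae_eq_Ici.symm, ← ofReal_integral_eq_lintegral_ofReal hint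
            ((ae_restrict_mem measurableSet_Ioi).mono fun l hl => by
              have hl0 : 0 < l := ha.trans hl
              positivity)]
          congr 1
          rw [integral_const_mul, integral_Ioi_rpow_of_lt (by linarith) ha,
            show a ^ p = a ^ (p - 3 + 1) * a ^ 2 by
              rw [← Real.rpow_add_natCast ha.ne']; push_cast; ring_nf]
          have : p - 3 + 1 ≠ 0 := by linarith
          have : 2 - p ≠ 0 := by linarith
          field_simp
          ring
  have := sub_pos.2 hp
  have := sub_pos.2 hp2
  rw [h1, h2, ← ENNReal.ofReal_add (by positivity) (by positivity),
    ← ENNReal.ofReal_mul (by positivity), add_mul]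

/-- Paley's inequality: `ℓ^p` controls the `L^p` norm of the Fourier transform with respect to
the weight `φ ^ (2 - p)`, for `φ` in weak `L^1`. -/
theorem lintegral_dft_rpow_mul_weight_le {d : ℕ} {p : ℝ} (hp : 1 < p) (hp2 : p < 2)
    {φ : (Fin d → ℝ) → ℝ} (hφm : Measurable φ) (hφ0 : ∀ x, 0 ≤ φ x) {c : ℝ} (hc : 0 ≤ c)
    (hφ : ∀ s : ℝ, 0 < s →
      volume.restrict (unitCube d) {x | s ≤ φ x} ≤ ENNReal.ofReal (c / s))
    {f : (Fin d → ℤ) → ℂ} (hf : Summable fun n => ‖f n‖) :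
    ∫⁻ x in unitCube d, ‖dft d f x‖ₑ ^ p * ENNReal.ofReal (φ x ^ (2 - p)) ≤
      ENNReal.ofReal (p * (4 * c / (p - 1) + 4 / (2 - p))) * ∑' n, ‖f n‖ₑ ^ p := by
  set μ := volume.restrict (unitCube d) with hμ
  have hp0 : 0 < p := by linarith
  have hFm : Measurable (dft d f) := (continuous_dft hf).measurable
  set ν := μ.withDensity (fun x => ENNReal.ofReal (φ x ^ 2)) with hν
  have hgm : Measurable fun x => ‖dft d f x‖ / φ x := hFm.norm.div hφm
  have hg0 : ∀ x, 0 ≤ ‖dft d f x‖ / φ x := fun x => div_nonneg (norm_nonneg _) (hφ0 x)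
  have h1 : ∫⁻ x, ‖dft d f x‖ₑ ^ p * ENNReal.ofReal (φ x ^ (2 - p)) ∂μ =
      ∫⁻ x, ENNReal.ofReal ((‖dft d f x‖ / φ x) ^ p) ∂ν := by
    rw [hν, lintegral_withDensity_eq_lintegral_mul _ (hφm.pow_const 2).ennreal_ofReal
      (hgm.pow_const p).ennreal_ofReal]
    refine lintegral_congr fun x => ?_
    rw [Pi.mul_apply, ← ofReal_norm, ENNReal.ofReal_rpow_of_nonneg (norm_nonneg _) hp0.le,
      ← ENNReal.ofReal_mul (by positivity), ← ENNReal.ofReal_mul (by positivity)]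
    congr 1
    rcases (hφ0 x).eq_or_lt with h | h
    · rw [← h, Real.zero_rpow (by linarith)]
      simp
    · rw [Real.div_rpow (norm_nonneg _) h.le, Real.rpow_sub h, Real.rpow_two]
      field_simp
  rw [h1, lintegral_rpow_eq_lintegral_meas_lt_mul ν (Filter.Eventually.of_forall hg0)
    hgm.aemeasurable hp0, ENNReal.ofReal_mul hp0.le, mul_assoc]
  gcongr
  calc _ ≤ ∫⁻ l in Set.Ioi (0 : ℝ),
        ∑' n, ((if l < ‖f n‖ then ENNReal.ofReal (4 * c / l * ‖f n‖) else 0) +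
        (if l < ‖f n‖ then 0 else ENNReal.ofReal (4 / l ^ 2 * ‖f n‖ ^ 2))) *
          ENNReal.ofReal (l ^ (p - 1)) := by
        refine setLIntegral_mono' measurableSet_Ioi fun l hl => ?_
        have hl : 0 < l := hl
        rw [ENNReal.tsum_mul_right]
        gcongr
        rw [hν, withDensity_apply _ (measurableSet_lt measurable_const hgm)]
        refine (lintegral_mono_set fun x hx => ?_).trans
          (setLIntegral_sq_lt_norm_dft_le hφm hφ0 hc hφ hf hl)
        have hx : l < ‖dft d f x‖ / φ x := hx
        rcases (hφ0 x).eq_or_lt with h | h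
        · rw [← h, div_zero] at hx
          exact absurd hx hl.not_gt
        · exact (lt_div_iff₀ h).1 hx
    _ = ∑' n, ∫⁻ l in Set.Ioi (0 : ℝ),
        ((if l < ‖f n‖ then ENNReal.ofReal (4 * c / l * ‖f n‖) else 0) +
        (if l < ‖f n‖ then 0 else ENNReal.ofReal (4 / l ^ 2 * ‖f n‖ ^ 2))) *
          ENNReal.ofReal (l ^ (p - 1)) := by
        refine lintegral_tsum fun n => Measurable.aemeasurable ?_
        refine Measurable.mul (Measurable.add ?_ ?_) (by fun_prop)
        · exact Measurable.ite measurableSet_Iio (by fun_prop) measurable_const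
        · exact Measurable.ite measurableSet_Iio measurable_const (by fun_prop)
    _ ≤ _ := by
        rw [← ENNReal.tsum_mul_left]
        refine ENNReal.tsum_le_tsum fun n => ?_
        rw [← ofReal_norm (f n), ENNReal.ofReal_rpow_of_nonneg (norm_nonneg _) hp0.le]
        exact lintegral_Ioi_ite_rpow_le hp hp2 hc (norm_nonneg _)

/-- The Hausdorff–Young inequality for the discrete Fourier transform, up to a constant. -/
theorem exists_lintegral_dft_rpow_conjExponent_le (d : ℕ) {p : ℝ} (hp : 1 < p) (hp2 : p ≤ 2) :
    ∃ K : ℝ, 0 ≤ K ∧ ∀ f : (Fin d → ℤ) → ℂ, Summable (fun n => ‖f n‖) →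
      ∫⁻ x in unitCube d, ‖dft d f x‖ₑ ^ (p / (p - 1)) ≤
        ENNReal.ofReal K * (∑' n, ‖f n‖ₑ ^ p) ^ (1 / (p - 1)) := by
  have := isProbabilityMeasure_unitCube d
  rcases hp2.eq_or_lt with rfl | hp2
  · refine ⟨1, zero_le_one, fun f hf => ?_⟩
    rw [show (2 : ℝ) / (2 - 1) = 2 by norm_num, show (1 : ℝ) / (2 - 1) = 1 by norm_num,
      lintegral_enorm_dft_sq hf]
    simp
  have hp1 : 0 < p - 1 := by linarith
  have hp2' : 0 < 2 - p := by linarith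
  set p' := p / (p - 1) with hp'
  have hp'0 : 0 < p' := by positivity
  set K := p * (4 * 1 / (p - 1) + 4 / (2 - p)) with hK
  have hK0 : 0 ≤ K := by positivity
  refine ⟨K ^ (1 / (p - 1)), by positivity, fun f hf => ?_⟩
  set N := ∫⁻ x in unitCube d, ‖dft d f x‖ₑ ^ p' with hN
  have hFm : Measurable (dft d f) := (continuous_dft hf).measurable
  have hNtop : N ≠ ⊤ := by
    refine ((lintegral_mono (g := fun _ => ENNReal.ofReal (∑' n, ‖f n‖) ^ p')
      fun x => ?_).trans_lt ?_).ne
    · rw [← ofReal_norm]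
      exact ENNReal.rpow_le_rpow (ENNReal.ofReal_le_ofReal (norm_dft_le hf x)) hp'0.le
    · rw [lintegral_const, measure_univ, mul_one]
      exact ENNReal.rpow_lt_top_of_nonneg hp'0.le ENNReal.ofReal_ne_top
  rcases eq_or_ne N 0 with hN0 | hN0
  · rw [hN0]
    exact zero_le
  have hNr : 0 < N.toReal := ENNReal.toReal_pos hN0 hNtop
  set φ : (Fin d → ℝ) → ℝ := fun x => ‖dft d f x‖ ^ p' / N.toReal with hφ
  have hφm : Measurable φ := (hFm.norm.pow_const p').div_const _
  have hφ0 : ∀ x, 0 ≤ φ x := fun x => by positivity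
  have hφint : ∫⁻ x in unitCube d, ENNReal.ofReal (φ x) = 1 := by
    have : ∀ x, ENNReal.ofReal (φ x) = ‖dft d f x‖ₑ ^ p' / N := fun x => by
      rw [hφ, ENNReal.ofReal_div_of_pos hNr, ENNReal.ofReal_toReal hNtop, ← ofReal_norm,
        ENNReal.ofReal_rpow_of_nonneg (norm_nonneg _) hp'0.le]
    simp_rw [this, div_eq_mul_inv]
    rw [lintegral_mul_const _ (hFm.enorm.pow_const _), ENNReal.mul_inv_cancel hN0 hNtop]
  have hweak : ∀ s : ℝ, 0 < s →
      volume.restrict (unitCube d) {x | s ≤ φ x} ≤ ENNReal.ofReal (1 / s) := fun s hs => by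
    have h := meas_ge_le_lintegral_div (μ := volume.restrict (unitCube d))
      hφm.ennreal_ofReal.aemeasurable
      (ENNReal.ofReal_pos.2 hs).ne' ENNReal.ofReal_ne_top
    rw [hφint, ← ENNReal.ofReal_one, ← ENNReal.ofReal_div_of_pos hs] at h
    exact (measure_mono fun x hx => ENNReal.ofReal_le_ofReal hx).trans h
  have key := lintegral_dft_rpow_mul_weight_le hp hp2 hφm hφ0 zero_le_one hweak hf
  rw [← hK] at key
  have hpt : ∀ x, ‖dft d f x‖ₑ ^ p * ENNReal.ofReal (φ x ^ (2 - p)) =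
      ‖dft d f x‖ₑ ^ p' * ENNReal.ofReal (N.toReal ^ (p - 2)) := fun x => by
    rw [← ofReal_norm, ENNReal.ofReal_rpow_of_nonneg (norm_nonneg _) (by linarith),
      ENNReal.ofReal_rpow_of_nonneg (norm_nonneg _) hp'0.le,
      ← ENNReal.ofReal_mul (by positivity), ← ENNReal.ofReal_mul (by positivity), hφ]
    congr 1
    rw [Real.div_rpow (by positivity) hNr.le, ← Real.rpow_mul (norm_nonneg _),
      div_eq_mul_inv, ← Real.rpow_neg hNr.le, neg_sub, ← mul_assoc,
      ← Real.rpow_add_of_nonneg (norm_nonneg _) (by linarith) (by positivity)]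
    congr 2
    rw [hp']
    field_simp
    ring
  simp_rw [hpt] at key
  rw [lintegral_mul_const _ (hFm.enorm.pow_const _), ← hN] at key
  have hpow : N * ENNReal.ofReal (N.toReal ^ (p - 2)) = N ^ (p - 1) := by
    rw [← ENNReal.ofReal_rpow_of_pos hNr, ENNReal.ofReal_toReal hNtop,
      show p - 1 = 1 + (p - 2) by ring, ENNReal.rpow_add _ _ hN0 hNtop, ENNReal.rpow_one]
  rw [hpow] at key
  rw [← ENNReal.ofReal_rpow_of_nonneg hK0 (by positivity),
    ← ENNReal.mul_rpow_of_nonneg _ _ (by positivity), one_div]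
  exact (ENNReal.le_rpow_inv_iff hp1).2 key

theorem exists_lintegral_mul_dft_mul_dft_le_of_le {d : ℕ} {m : (Fin d → ℝ) → ℂ}
    (hm : Measurable m) {α : ℝ} (hα : 1 < α) {c : ℝ} (hc : 0 < c)
    (hweak : ∀ s : ℝ, 0 < s →
      volume {ξ ∈ unitCube d | s ≤ ‖m ξ‖} ≤ ENNReal.ofReal (c / s ^ α))
    {r s : ℝ} (hr : 1 < r) (hrs : r ≤ s) (hs2 : s ≤ 2) (h : 1 / r + 1 / s = 1 + 1 / α) :
    ∃ K : ℝ, 0 ≤ K ∧ ∀ f g : (Fin d → ℤ) → ℂ, Summable (fun n => ‖f n‖) →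
      Summable (fun n => ‖g n‖) →
      ∫⁻ x in unitCube d, ‖m x‖ₑ * ‖dft d f x‖ₑ * ‖dft d g x‖ₑ ≤
        ENNReal.ofReal K * (∑' n, ‖f n‖ₑ ^ r) ^ (1 / r) * (∑' n, ‖g n‖ₑ ^ s) ^ (1 / s) := by
  have hα0 : 0 < α := by linarith
  have hr0 : 0 < r := by linarith
  have hs : 1 < s := hr.trans_le hrs
  have hs0 : 0 < s := by linarith
  have hinv : 1 / s ≤ 1 / r := one_div_le_one_div_of_le hr0 hrs
  have hα' : 0 < 1 / α := by positivity
  have hr2 : r < 2 := by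
    by_contra hcon
    have : 1 / r ≤ 1 / 2 := one_div_le_one_div_of_le two_pos (not_lt.1 hcon)
    linarith
  have hr1 : 0 < r - 1 := by linarith
  have hs1 : 0 < s - 1 := by linarith
  have hr2' : 0 < 2 - r := by linarith
  obtain ⟨K₂, hK₂0, hK₂⟩ := exists_lintegral_dft_rpow_conjExponent_le d hr hr2.le
  obtain ⟨K₃, hK₃0, hK₃⟩ := exists_lintegral_dft_rpow_conjExponent_le d hs hs2
  set K₁ := r * (4 * c / (r - 1) + 4 / (2 - r)) with hK₁
  have hK₁0 : 0 ≤ K₁ := by positivity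
  set θ₁ := 1 / (α * (2 - r)) with hθ₁
  set θ₂ := (1 - r * θ₁) * ((r - 1) / r) with hθ₂
  set θ₃ := (s - 1) / s with hθ₃
  have hθ₁0 : 0 ≤ θ₁ := by positivity
  have hrθ : r * θ₁ ≤ 1 := by
    have h1 : 1 / α ≤ 2 * (1 / r) - 1 := by linarith
    have h2 : r * (1 / α) ≤ 2 - r := by
      calc r * (1 / α) ≤ r * (2 * (1 / r) - 1) := by gcongr
        _ = 2 - r := by field_simp
    rw [hθ₁, one_div, mul_inv, ← mul_assoc, ← one_div, ← div_eq_mul_inv, div_le_one hr2']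
    exact h2
  have hθ₂0 : 0 ≤ θ₂ := mul_nonneg (by linarith) (by positivity)
  have hθ₃0 : 0 ≤ θ₃ := by positivity
  have hθα : α * (2 - r) * θ₁ = 1 := by
    rw [hθ₁]
    field_simp
  have hθr : r * θ₁ + r / (r - 1) * θ₂ = 1 := by
    rw [hθ₂]
    field_simp
    ring
  have hθs : s / (s - 1) * θ₃ = 1 := by
    rw [hθ₃]
    field_simp
  have hsum : θ₁ + θ₂ + θ₃ = 1 := by
    have h1 : θ₁ * (2 - r) = 1 / α := by
      rw [hθ₁]
      field_simp
    have h2 : θ₂ = 1 - 1 / r - θ₁ * (r - 1) := by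
      rw [hθ₂]
      field_simp
    have h3 : θ₃ = 1 - 1 / s := by
      rw [hθ₃]
      field_simp
    linarith
  have hA : θ₁ + 1 / (r - 1) * θ₂ = 1 / r := by
    rw [hθ₂]
    field_simp
    ring
  have hB : 1 / (s - 1) * θ₃ = 1 / s := by
    rw [hθ₃]
    field_simp
  have hφ : ∀ t : ℝ, 0 < t →
      volume.restrict (unitCube d) {x | t ≤ ‖m x‖ ^ α} ≤ ENNReal.ofReal (c / t) := fun t ht => by
    have hset : {x | t ≤ ‖m x‖ ^ α} ∩ unitCube d = {ξ ∈ unitCube d | t ^ α⁻¹ ≤ ‖m ξ‖} := by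
      ext x
      simp only [Set.mem_inter_iff, Set.mem_ofPred_eq,
        Real.rpow_inv_le_iff_of_pos ht.le (norm_nonneg (m x)) hα0, and_comm]
    rw [Measure.restrict_apply (measurableSet_le measurable_const (hm.norm.pow_const α)), hset]
    refine (hweak _ (by positivity)).trans_eq ?_
    rw [Real.rpow_inv_rpow ht.le hα0.ne']
  refine ⟨K₁ ^ θ₁ * K₂ ^ θ₂ * K₃ ^ θ₃, by positivity, fun f g hf hg => ?_⟩
  have hFm : Measurable (dft d f) := (continuous_dft hf).measurable
  have hGm : Measurable (dft d g) := (continuous_dft hg).measurable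
  have hpaley := lintegral_dft_rpow_mul_weight_le hr hr2 (hm.norm.pow_const α)
    (fun x => by positivity) hc.le hφ hf
  rw [← hK₁] at hpaley
  set A := ∑' n, ‖f n‖ₑ ^ r
  set B := ∑' n, ‖g n‖ₑ ^ s
  have hpt : ∀ x, ‖m x‖ₑ * ‖dft d f x‖ₑ * ‖dft d g x‖ₑ =
      (‖dft d f x‖ₑ ^ r * ENNReal.ofReal ((‖m x‖ ^ α) ^ (2 - r))) ^ θ₁ *
        (‖dft d f x‖ₑ ^ (r / (r - 1))) ^ θ₂ * (‖dft d g x‖ₑ ^ (s / (s - 1))) ^ θ₃ := fun x => by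
    rw [← Real.rpow_mul (norm_nonneg _), ← ENNReal.ofReal_rpow_of_nonneg (norm_nonneg _)
      (by positivity), ofReal_norm, ENNReal.mul_rpow_of_nonneg _ _ hθ₁0, ← ENNReal.rpow_mul,
      ← ENNReal.rpow_mul, ← ENNReal.rpow_mul, ← ENNReal.rpow_mul, hθα, hθs, ENNReal.rpow_one,
      ENNReal.rpow_one, mul_comm (_ ^ (r * θ₁)) ‖m x‖ₑ, mul_assoc ‖m x‖ₑ (_ ^ _),
      ← ENNReal.rpow_add_of_nonneg _ _ (by positivity) (by positivity), hθr, ENNReal.rpow_one]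
  have hholder := ENNReal.lintegral_prod_norm_pow_le (μ := volume.restrict (unitCube d))
    (Finset.univ : Finset (Fin 3))
    (f := ![fun x => ‖dft d f x‖ₑ ^ r * ENNReal.ofReal ((‖m x‖ ^ α) ^ (2 - r)),
      fun x => ‖dft d f x‖ₑ ^ (r / (r - 1)), fun x => ‖dft d g x‖ₑ ^ (s / (s - 1))])
    (p := ![θ₁, θ₂, θ₃])
    (fun i _ => by
      refine Measurable.aemeasurable ?_
      fin_cases i
      · exact (hFm.enorm.pow_const _).mul ((hm.norm.pow_const _).pow_const _).ennreal_ofReal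
      · exact hFm.enorm.pow_const _
      · exact hGm.enorm.pow_const _)
    (by simpa [Fin.sum_univ_three] using hsum)
    (fun i _ => by fin_cases i <;> simpa)
  simp only [Fin.prod_univ_three, Matrix.cons_val_zero, Matrix.cons_val_one,
    Matrix.cons_val] at hholder
  simp_rw [hpt]
  refine hholder.trans ?_
  calc _ ≤ (ENNReal.ofReal K₁ * A) ^ θ₁ * (ENNReal.ofReal K₂ * A ^ (1 / (r - 1))) ^ θ₂ *
        (ENNReal.ofReal K₃ * B ^ (1 / (s - 1))) ^ θ₃ := by
        gcongr
        · exact hK₂ f hf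
        · exact hK₃ g hg
    _ = _ := by
        rw [ENNReal.mul_rpow_of_nonneg _ _ hθ₁0, ENNReal.mul_rpow_of_nonneg _ _ hθ₂0,
          ENNReal.mul_rpow_of_nonneg _ _ hθ₃0, ← ENNReal.rpow_mul, ← ENNReal.rpow_mul, hB, ← hA,
          ENNReal.rpow_add_of_nonneg _ _ hθ₁0 (by positivity),
          ENNReal.ofReal_mul (p := K₁ ^ θ₁ * K₂ ^ θ₂) (by positivity),
          ENNReal.ofReal_mul (p := K₁ ^ θ₁) (by positivity),
          ENNReal.ofReal_rpow_of_nonneg hK₁0 hθ₁0, ENNReal.ofReal_rpow_of_nonneg hK₂0 hθ₂0,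
          ENNReal.ofReal_rpow_of_nonneg hK₃0 hθ₃0]
        ring

theorem exists_lintegral_mul_dft_mul_dft_le {d : ℕ} {m : (Fin d → ℝ) → ℂ}
    (hm : Measurable m) {α : ℝ} (hα : 1 < α) {c : ℝ} (hc : 0 < c)
    (hweak : ∀ s : ℝ, 0 < s →
      volume {ξ ∈ unitCube d | s ≤ ‖m ξ‖} ≤ ENNReal.ofReal (c / s ^ α))
    {r s : ℝ} (hr : 1 < r) (hr2 : r ≤ 2) (hs : 1 < s) (hs2 : s ≤ 2)
    (h : 1 / r + 1 / s = 1 + 1 / α) :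
    ∃ K : ℝ, 0 ≤ K ∧ ∀ f g : (Fin d → ℤ) → ℂ, Summable (fun n => ‖f n‖) →
      Summable (fun n => ‖g n‖) →
      ∫⁻ x in unitCube d, ‖m x‖ₑ * ‖dft d f x‖ₑ * ‖dft d g x‖ₑ ≤
        ENNReal.ofReal K * (∑' n, ‖f n‖ₑ ^ r) ^ (1 / r) * (∑' n, ‖g n‖ₑ ^ s) ^ (1 / s) := by
  rcases le_total r s with hrs | hrs
  · exact exists_lintegral_mul_dft_mul_dft_le_of_le hm hα hc hweak hr hrs hs2 h
  · obtain ⟨K, hK0, hK⟩ := exists_lintegral_mul_dft_mul_dft_le_of_le hm hα hc hweak hs hrs hr2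
      (by rw [add_comm]; exact h)
    refine ⟨K, hK0, fun f g hf hg => ?_⟩
    rw [mul_right_comm]
    refine (lintegral_congr fun x => mul_right_comm _ _ _).trans_le (hK g f hg hf)

theorem Tmult_eq_integral_mul_conj (d : ℕ) (m : (Fin d → ℝ) → ℂ) (f : (Fin d → ℤ) → ℂ)
    (n : Fin d → ℤ) :
    Tmult d m f n =
      ∫ ξ in unitCube d, m ξ * dft d f ξ * (starRingEnd ℂ) (latticeChar d n ξ) := by
  simp_rw [conj_latticeChar]
  rfl

theorem sum_Tmult_mul_conj {d : ℕ} {m : (Fin d → ℝ) → ℂ} {f : (Fin d → ℤ) → ℂ}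
    (hint : Integrable (fun ξ => m ξ * dft d f ξ) (volume.restrict (unitCube d)))
    {S : Finset (Fin d → ℤ)} {g : (Fin d → ℤ) → ℂ} (hg : ∀ n ∉ S, g n = 0) :
    ∑ n ∈ S, Tmult d m f n * (starRingEnd ℂ) (g n) =
      ∫ ξ in unitCube d, m ξ * dft d f ξ * (starRingEnd ℂ) (dft d g ξ) := by
  have hG : ∀ ξ, dft d g ξ = ∑ n ∈ S, g n * latticeChar d n ξ := fun ξ =>
    tsum_eq_sum fun n hn => by simp [hg n hn]
  simp_rw [hG, map_sum, map_mul, Finset.mul_sum, Tmult_eq_integral_mul_conj]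
  rw [integral_finsetSum]
  · refine Finset.sum_congr rfl fun n _ => ?_
    rw [← integral_mul_const]
    congr 1
    ext ξ
    ring
  · intro n _
    refine hint.mul_bdd (c := ‖g n‖) (Continuous.aestronglyMeasurable ?_)
      (Filter.Eventually.of_forall fun ξ => ?_)
    · exact continuous_const.mul (Complex.continuous_conj.comp (continuous_latticeChar d n))
    · simp [norm_latticeChar]

theorem Tmult_eq_zero_of_not_integrable {d : ℕ} {m : (Fin d → ℝ) → ℂ} {f : (Fin d → ℤ) → ℂ}
    (hint : ¬ Integrable (fun ξ => m ξ * dft d f ξ) (volume.restrict (unitCube d)))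
    (n : Fin d → ℤ) : Tmult d m f n = 0 := by
  rw [Tmult_eq_integral_mul_conj]
  refine integral_undef fun h => hint ?_
  have h' := h.mul_bdd (c := 1) (continuous_latticeChar d n).aestronglyMeasurable
    (Filter.Eventually.of_forall fun ξ => (norm_latticeChar d n ξ).le)
  refine h'.congr (Filter.Eventually.of_forall fun ξ => ?_)
  have h1 : (starRingEnd ℂ) (latticeChar d n ξ) * latticeChar d n ξ = 1 := by
    rw [Complex.conj_mul', norm_latticeChar]
    simp
  simp only [mul_assoc, h1, mul_one]

theorem lpNorm_eq_tsum_rpow {d : ℕ} (f : (Fin d → ℤ) → ℂ) {p : ℝ} (hp : 0 < p) :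
    lpNorm d f p = (∑' n, ‖f n‖ₑ ^ p) ^ (1 / p) := by
  rw [_root_.lpNorm, eLpNorm_eq_lintegral_rpow_enorm_toReal (by simpa using hp) ENNReal.ofReal_ne_top,
    ENNReal.toReal_ofReal hp.le, lintegral_count]

/-- Hörmander-type theorem: if `m ∈ L^{α,∞}(𝕋^d)` with `α > 1`, then `T_m` is bounded
from `ℓ^p(ℤ^d)` to `ℓ^q(ℤ^d)` whenever `1 < p ≤ 2 ≤ q < ∞` and `1/p − 1/q = 1/α`. -/
theorem stmt_4 (d : ℕ) (m : (Fin d → ℝ) → ℂ) (hm : Measurable m)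
    (α : ℝ) (hα : 1 < α) (c : ℝ) (hc : 0 < c)
    (hweak : ∀ s : ℝ, 0 < s →
      volume {ξ ∈ unitCube d | s ≤ ‖m ξ‖} ≤ ENNReal.ofReal (c / s ^ α))
    (p q : ℝ) (hp : 1 < p) (hp2 : p ≤ 2) (h2q : 2 ≤ q)
    (hpq : 1 / p - 1 / q = 1 / α) :
    ∃ C : ℝ, 0 < C ∧ ∀ f : (Fin d → ℤ) → ℂ, Summable (fun n => ‖f n‖) →
      lpNorm d (Tmult d m f) q ≤ ENNReal.ofReal C * lpNorm d f p := by
  have hq0 : 0 < q := by linarith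
  have hq1 : 0 < q - 1 := by linarith
  have hp0 : 0 < p := by linarith
  have hs : 1 / (q / (q - 1)) = 1 - 1 / q := by field_simp
  obtain ⟨K, hK0, hK⟩ := exists_lintegral_mul_dft_mul_dft_le hm hα hc hweak hp hp2
    (s := q / (q - 1)) (by rw [lt_div_iff₀ hq1]; linarith)
    (by rw [div_le_iff₀ hq1]; linarith) (by rw [hs]; linarith)
  refine ⟨K + 1, by linarith, fun f hf => ?_⟩
  by_cases hint : Integrable (fun ξ => m ξ * dft d f ξ) (volume.restrict (unitCube d))
  swap
  · have : Tmult d m f = 0 := funext fun n => Tmult_eq_zero_of_not_integrable hint n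
    simp [this, _root_.lpNorm]
  refine le_trans ?_ (mul_le_mul_left (ENNReal.ofReal_le_ofReal (show K ≤ K + 1 by linarith)) _)
  rw [lpNorm_eq_tsum_rpow _ hq0, lpNorm_eq_tsum_rpow _ hp0, one_div q,
    ENNReal.rpow_inv_le_iff hq0, ENNReal.tsum_eq_iSup_sum]
  refine iSup_le fun S => ?_
  set T := Tmult d m f with hT
  set X := ∑ n ∈ S, ‖T n‖ₑ ^ q with hX
  set A := ∑' n, ‖f n‖ₑ ^ p with hA
  have hXtop : X ≠ ⊤ :=
    ENNReal.sum_ne_top.2 fun n _ => ENNReal.rpow_ne_top_of_nonneg hq0.le enorm_ne_top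
  rcases eq_or_ne X 0 with hX0 | hX0
  · rw [hX0]
    exact zero_le
  set g : (Fin d → ℤ) → ℂ := fun n => if n ∈ S then ((‖T n‖ ^ (q - 2) : ℝ) : ℂ) * T n else 0
    with hg
  have hgS : ∀ n ∉ S, g n = 0 := fun n hn => by simp [hg, hn]
  have hgsum : Summable fun n => ‖g n‖ :=
    summable_of_ne_finset_zero (s := S) fun n hn => by rw [hgS n hn, norm_zero]
  have hgn : ∀ n ∈ S, ‖g n‖ = ‖T n‖ ^ (q - 1) := fun n hn => by
    simp only [hg, hn, if_true, norm_mul, Complex.norm_real, Real.norm_eq_abs]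
    rw [abs_of_nonneg (by positivity), show q - 1 = (q - 2) + 1 by ring]
    rcases (norm_nonneg (T n)).eq_or_lt with h | h
    · rw [← h, Real.zero_rpow (by linarith : q - 2 + 1 ≠ 0), mul_zero]
    · rw [Real.rpow_add_one h.ne']
  have hB : ∑' n, ‖g n‖ₑ ^ (q / (q - 1)) = X := by
    rw [tsum_eq_sum (s := S) fun n hn => by simp [hgS n hn, div_pos hq0 hq1]]
    refine Finset.sum_congr rfl fun n hn => ?_
    rw [← ofReal_norm, hgn n hn, ← ENNReal.ofReal_rpow_of_nonneg (norm_nonneg _) hq1.le,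
      ofReal_norm, ← ENNReal.rpow_mul, mul_div_cancel₀ _ hq1.ne']
  have hpair : ∑ n ∈ S, T n * (starRingEnd ℂ) (g n) = ((∑ n ∈ S, ‖T n‖ ^ q : ℝ) : ℂ) := by
    rw [Complex.ofReal_sum]
    refine Finset.sum_congr rfl fun n hn => ?_
    simp only [hg, hn, if_true, map_mul, Complex.conj_ofReal]
    rw [mul_left_comm, Complex.mul_conj, Complex.normSq_eq_norm_sq, ← Complex.ofReal_mul]
    congr 1
    rcases (norm_nonneg (T n)).eq_or_lt with h | h
    · rw [← h, Real.zero_rpow hq0.ne']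
      simp
    · rw [← Real.rpow_natCast, ← Real.rpow_add h]
      norm_num
  have hXnorm : X = ‖((∑ n ∈ S, ‖T n‖ ^ q : ℝ) : ℂ)‖ₑ := by
    rw [← ofReal_norm, Complex.norm_real, Real.norm_of_nonneg (by positivity),
      ENNReal.ofReal_sum_of_nonneg fun n _ => by positivity]
    refine Finset.sum_congr rfl fun n _ => ?_
    rw [← ofReal_norm, ENNReal.ofReal_rpow_of_nonneg (norm_nonneg _) hq0.le]
  have hmain : X ≤ ENNReal.ofReal K * A ^ (1 / p) * X ^ (1 - 1 / q) := by
    calc X = ‖∫ ξ in unitCube d, m ξ * dft d f ξ * (starRingEnd ℂ) (dft d g ξ)‖ₑ := by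
          rw [← sum_Tmult_mul_conj hint hgS, ← hT, hpair, hXnorm]
      _ ≤ ∫⁻ ξ in unitCube d, ‖m ξ * dft d f ξ * (starRingEnd ℂ) (dft d g ξ)‖ₑ :=
          enorm_integral_le_lintegral_enorm _
      _ = ∫⁻ ξ in unitCube d, ‖m ξ‖ₑ * ‖dft d f ξ‖ₑ * ‖dft d g ξ‖ₑ := by
          simp only [enorm_mul, RCLike.enorm_conj]
      _ ≤ _ := by
          have := hK f g hf hgsum
          rwa [hB, hs] at this
  have hsplit : X = X ^ (1 / q) * X ^ (1 - 1 / q) := by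
    rw [← ENNReal.rpow_add _ _ hX0 hXtop, add_sub_cancel, ENNReal.rpow_one]
  have hfin : X ^ (1 / q) ≤ ENNReal.ofReal K * A ^ (1 / p) := by
    refine (ENNReal.mul_le_mul_iff_left (c := X ^ (1 - 1 / q)) ?_ ?_).1
      (hsplit.symm.trans_le hmain)
    · simp [ENNReal.rpow_eq_zero_iff, hX0, hXtop]
    · simp [ENNReal.rpow_eq_top_iff, hX0, hXtop]
  rwa [one_div, ENNReal.rpow_inv_le_iff hq0] at hfin
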